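/- arXiv:1302.4209 — 2 statements merged into one kernel-verified Lean document; each statement's English description precedes it below -/
import Mathlib

section
/- Let d ≥ 4 and let G be a finite d-regular simple graph containing no cycle of order 4 (no C₄ subgraph). If G has at least d³ + d vertices, then the b-chromatic number of G equals d + 1, i.e., G admits a proper vertex coloring with d + 1 colors in which every one of the d + 1 color classes contains a vertex adjacent to at least one vertex of each of the other d color classes. -/
/-- A b-coloring of `G` with `k` colors: a proper coloring `c : V → Fin k` such that
every color class contains a vertex adjacent to at least one vertex of each other color class. -/
def IsBColoring {V : Type*} (G : SimpleGraph V) (k : ℕ) (c : V → Fin k) : Prop :=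
  (∀ u v : V, G.Adj u v → c u ≠ c v) ∧
  ∀ i : Fin k, ∃ v : V, c v = i ∧ ∀ j : Fin k, j ≠ i → ∃ w : V, G.Adj v w ∧ c w = j

/-- The b-chromatic number of `G`: the largest `k` such that `G` admits a b-coloring
with `k` colors. -/
noncomputable def bChromaticNumber {V : Type*} (G : SimpleGraph V) : ℕ :=
  sSup {k : ℕ | ∃ c : V → Fin k, IsBColoring G k c}

open Finset in
/-- A version of Hall's theorem: if fewer than `2 * d - 2` pairs of a `d × d` grid are forbidden and
no row or column is entirely forbidden, then some bijection avoids all the forbidden pairs. -/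
theorem exists_injOn_avoiding {α β : Type*} [DecidableEq β] {d : ℕ}
    (A : Finset α) (C : Finset β) (F : α → β → Prop) [∀ a, DecidablePred (F a)]
    [∀ b, DecidablePred fun a => F a b]
    (hA : #A = d) (hC : #C = d)
    (hrow : ∀ a ∈ A, #{b ∈ C | F a b} < d) (hcol : ∀ b ∈ C, #{a ∈ A | F a b} < d)
    (htotal : ∑ a ∈ A, #{b ∈ C | F a b} + 3 ≤ 2 * d) :
    ∃ f : α → β, Set.InjOn f A ∧ ∀ a ∈ A, f a ∈ C ∧ ¬ F a (f a) := by
  classical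
  have hall : ∃ f : A → β, Function.Injective f ∧ ∀ a : A, f a ∈ ({b ∈ C | ¬ F a b} : Finset β) := by
    rw [← Finset.all_card_le_biUnion_card_iff_exists_injective]
    intro s
    by_contra! hlt
    set B := s.biUnion fun a : A => ({b ∈ C | ¬ F a b} : Finset β) with hB
    have hBC : B ⊆ C := by
      intro b hb
      simp only [hB, mem_biUnion, mem_filter] at hb
      exact hb.choose_spec.2.1
    have hF : ∀ a ∈ s, ∀ b ∈ C \ B, F a b := by
      intro a ha b hb
      by_contra hn
      rw [mem_sdiff] at hb
      exact hb.2 (mem_biUnion.2 ⟨a, ha, mem_filter.2 ⟨hb.1, hn⟩⟩)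
    have hcB : #(C \ B) + #B = d := by rw [card_sdiff_add_card_eq_card hBC, hC]
    have hsd : #s ≤ d := by
      have := card_le_univ s
      rwa [Fintype.card_coe, hA] at this
    have hrow_ge : ∀ a ∈ s, #(C \ B) ≤ #{b ∈ C | F a b} := fun a ha =>
      card_le_card fun b hb => mem_filter.2 ⟨(mem_sdiff.1 hb).1, hF a ha b hb⟩
    obtain ⟨a, ha⟩ : s.Nonempty := card_pos.1 (by omega)
    have h1 := (hrow_ge a ha).trans_lt (hrow a a.2)
    obtain ⟨b, hb⟩ : (C \ B).Nonempty := card_pos.1 (by omega)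
    have h2 : #s < d := by
      refine lt_of_le_of_lt ?_ (hcol b (mem_sdiff.1 hb).1)
      rw [← card_map (Function.Embedding.subtype _)]
      refine card_le_card fun y hy => ?_
      obtain ⟨z, hz, rfl⟩ := mem_map.1 hy
      exact mem_filter.2 ⟨z.2, hF z hz b hb⟩
    have h3 : #s * #(C \ B) ≤ ∑ a ∈ A, #{b ∈ C | F a b} := by
      rw [← Finset.sum_coe_sort A, ← smul_eq_mul]
      exact (card_nsmul_le_sum s _ _ hrow_ge).trans
        (sum_le_sum_of_subset (subset_univ s))
    have h4 : 2 ≤ #(C \ B) ∧ 2 ≤ #s := by omega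
    obtain ⟨p, hp⟩ := Nat.exists_eq_add_of_le h4.1
    obtain ⟨q, hq⟩ := Nat.exists_eq_add_of_le h4.2
    rw [hp, hq] at h3
    nlinarith [Nat.zero_le (p * q)]
  obtain ⟨f, hf, hfm⟩ := hall
  obtain ⟨b₀, -⟩ : C.Nonempty := card_pos.1 (by omega)
  refine ⟨fun a => if h : a ∈ A then f ⟨a, h⟩ else b₀, ?_, ?_⟩
  · intro a ha b hb hab
    rw [mem_coe] at ha hb
    simp only [ha, hb, dif_pos] at hab
    exact congrArg Subtype.val (hf hab)
  · intro a ha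
    simpa [ha] using hfm ⟨a, ha⟩

namespace SimpleGraph

open Finset

theorem le_of_isBColoring {V : Type*} [Fintype V] {G : SimpleGraph V} [DecidableRel G.Adj] {d : ℕ}
    (hreg : G.IsRegularOfDegree d) {k : ℕ} {c : V → Fin k}
    (h : IsBColoring G k c) : k ≤ d + 1 := by
  cases k with
  | zero => omega
  | succ k =>
    obtain ⟨v, -, hv⟩ := h.2 0
    have hsub : univ.erase (0 : Fin (k + 1)) ⊆ (G.neighborFinset v).image c := by
      intro j hj
      obtain ⟨w, hw, hwj⟩ := hv j (mem_erase.1 hj).1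
      exact mem_image.2 ⟨w, by simpa using hw, hwj⟩
    have := (card_le_card hsub).trans card_image_le
    rw [card_neighborFinset_eq_degree, hreg v, card_erase_of_mem (mem_univ _), card_univ,
      Fintype.card_fin] at this
    omega

variable {V : Type*} [Fintype V] [DecidableEq V] (G : SimpleGraph V) [DecidableRel G.Adj] {d : ℕ}

/-- A proper coloring of the vertices in `P` in which, for every `i < k`, the vertex `v i` has
color `i` and sees all its neighbors in `P` and with distinct colors; moreover `P` is covered by
the closed neighborhoods of these vertices. -/
structure IsPartialBColoring (k : ℕ) (P : Finset V) (c : V → Fin (d + 1)) (v : Fin (d + 1) → V) :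
    Prop where
  proper : ∀ u ∈ P, ∀ w ∈ P, G.Adj u w → c u ≠ c w
  mem : ∀ i : Fin (d + 1), i.val < k → v i ∈ P
  color : ∀ i : Fin (d + 1), i.val < k → c (v i) = i
  closed : ∀ i : Fin (d + 1), i.val < k → ∀ w, G.Adj (v i) w → w ∈ P
  injOn : ∀ i : Fin (d + 1), i.val < k → Set.InjOn c (G.neighborSet (v i))
  cover : ∀ s ∈ P, ∃ i : Fin (d + 1), i.val < k ∧ (s = v i ∨ G.Adj (v i) s)

/-- The closed neighborhood of a vertex. -/
def closedNeighborFinset (x : V) : Finset V := insert x (G.neighborFinset x)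

/-- The number of vertices in `P` plus the number of edges leaving `P`. -/
def boundaryWeight (P : Finset V) : ℕ := ∑ u ∈ P, (1 + #(G.neighborFinset u \ P))

variable {G}

theorem mem_closedNeighborFinset {x y : V} :
    y ∈ G.closedNeighborFinset x ↔ y = x ∨ G.Adj x y := by
  simp [closedNeighborFinset]

theorem boundaryWeight_union_add_card_inter_le (P Q : Finset V) :
    G.boundaryWeight (P ∪ Q) + #(P ∩ Q) ≤ G.boundaryWeight P + G.boundaryWeight Q := by
  have hP : ∑ u ∈ P, (1 + #(G.neighborFinset u \ (P ∪ Q))) ≤ G.boundaryWeight P :=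
    sum_le_sum fun u _ => by gcongr; exact subset_union_left
  have hQ : ∑ u ∈ Q, (1 + #(G.neighborFinset u \ (P ∪ Q))) ≤ G.boundaryWeight Q :=
    sum_le_sum fun u _ => by gcongr; exact subset_union_right
  have hI : #(P ∩ Q) ≤ ∑ u ∈ P ∩ Q, (1 + #(G.neighborFinset u \ (P ∪ Q))) := by
    rw [card_eq_sum_ones]
    exact sum_le_sum fun u _ => Nat.le_add_right _ _
  have := sum_union_inter (s₁ := P) (s₂ := Q) (f := fun u => 1 + #(G.neighborFinset u \ (P ∪ Q)))
  unfold boundaryWeight at *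
  omega

theorem boundaryWeight_closedNeighborFinset (x : V) :
    G.boundaryWeight (G.closedNeighborFinset x) =
      1 + ∑ u ∈ G.neighborFinset x, (1 + #(G.neighborFinset u \ G.closedNeighborFinset x)) := by
  have h0 : #(G.neighborFinset x \ G.closedNeighborFinset x) = 0 := by
    rw [card_eq_zero, sdiff_eq_empty_iff_subset]
    exact subset_insert _ _
  unfold boundaryWeight
  nth_rewrite 1 [closedNeighborFinset]
  rw [sum_insert (by simp), h0]

theorem one_add_card_sdiff_closedNeighborFinset_le (hreg : G.IsRegularOfDegree d) {x u : V}
    (h : G.Adj x u) : 1 + #(G.neighborFinset u \ G.closedNeighborFinset x) ≤ d := by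
  rw [← hreg u, ← card_neighborFinset_eq_degree, add_comm]
  refine card_lt_card ⟨sdiff_subset, fun hs => ?_⟩
  have := hs ((G.mem_neighborFinset u x).2 h.symm)
  simp [mem_closedNeighborFinset] at this

theorem boundaryWeight_closedNeighborFinset_le (hreg : G.IsRegularOfDegree d) (x : V) :
    G.boundaryWeight (G.closedNeighborFinset x) ≤ d ^ 2 + 1 := by
  rw [boundaryWeight_closedNeighborFinset, add_comm, pow_two]
  gcongr
  have := sum_le_card_nsmul (G.neighborFinset x) _ d fun u hu =>
    one_add_card_sdiff_closedNeighborFinset_le hreg ((G.mem_neighborFinset x u).1 hu)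
  rwa [card_neighborFinset_eq_degree, hreg x, smul_eq_mul] at this

theorem boundaryWeight_closedNeighborFinset_lt (hreg : G.IsRegularOfDegree d) {x y z : V}
    (hxy : G.Adj x y) (hxz : G.Adj x z) (hyz : G.Adj y z) :
    G.boundaryWeight (G.closedNeighborFinset x) < d ^ 2 + 1 := by
  rw [boundaryWeight_closedNeighborFinset, add_comm, pow_two]
  have hlt : ∑ u ∈ G.neighborFinset x, (1 + #(G.neighborFinset u \ G.closedNeighborFinset x)) <
      ∑ u ∈ G.neighborFinset x, d := by
    refine sum_lt_sum (fun u hu =>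
      one_add_card_sdiff_closedNeighborFinset_le hreg ((G.mem_neighborFinset x u).1 hu))
      ⟨y, (G.mem_neighborFinset x y).2 hxy, ?_⟩
    have hsub : insert x (insert z (G.neighborFinset y \ G.closedNeighborFinset x)) ⊆
        G.neighborFinset y := by
      intro w hw
      simp only [mem_insert, mem_sdiff] at hw
      rcases hw with rfl | rfl | hw
      · simpa using hxy.symm
      · simpa using hyz
      · exact hw.1
    have := card_le_card hsub
    rw [card_insert_of_notMem, card_insert_of_notMem, card_neighborFinset_eq_degree, hreg y] at this
    · omega
    · simp [mem_closedNeighborFinset, hxz]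
    · simp [mem_closedNeighborFinset, hxz.ne]
  rw [sum_const, card_neighborFinset_eq_degree, hreg x, smul_eq_mul] at hlt
  omega

theorem sum_card_neighborFinset_inter_comm (s t : Finset V) :
    ∑ u ∈ s, #(G.neighborFinset u ∩ t) = ∑ u ∈ t, #(G.neighborFinset u ∩ s) := by
  have h := sum_card_bipartiteAbove_eq_sum_card_bipartiteBelow (s := s) (t := t) G.Adj
  simp only [bipartiteAbove, bipartiteBelow] at h
  convert h using 3 with u _ u _
  · ext w; simp [and_comm]
  · ext w; simp [and_comm, G.adj_comm]

/-- If `G` has more than `boundaryWeight P` vertices, some vertex is neither in `P` nor adjacent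
to `P`, and there are few edges between its neighborhood and `P`. -/
theorem exists_far_vertex (hd : 3 ≤ d) (hreg : G.IsRegularOfDegree d) (P : Finset V)
    (hP : G.boundaryWeight P < Fintype.card V) :
    ∃ x, x ∉ P ∧ (∀ u, G.Adj x u → u ∉ P) ∧
      ∑ u ∈ G.neighborFinset x, #(G.neighborFinset u ∩ P) + 3 ≤ 2 * d := by
  by_contra! hbad
  set t : V → ℕ := fun u => #(G.neighborFinset u ∩ P) with ht
  set T : Finset V := {u ∈ Pᶜ | 0 < t u} with hT
  set B : Finset V := {u ∈ Pᶜ | t u = 0} with hB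
  have hcard : #P + (#T + #B) = Fintype.card V := by
    have : #T + #B = #Pᶜ := by
      rw [hT, hB, ← card_filter_add_card_filter_not (s := Pᶜ) (fun u => 0 < t u)]
      simp
    rw [this, card_add_card_compl]
  have hw : G.boundaryWeight P = #P + ∑ u ∈ T, t u := by
    have h1 : ∑ u ∈ P, #(G.neighborFinset u \ P) = ∑ u ∈ Pᶜ, t u := by
      rw [ht, ← sum_card_neighborFinset_inter_comm]
      simp only [sdiff_eq_inter_compl]
    have h2 : ∑ u ∈ T, t u = ∑ u ∈ Pᶜ, t u :=
      sum_subset (filter_subset _ _) fun u hu hn => by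
        by_contra h0
        exact hn (mem_filter.2 ⟨hu, Nat.pos_of_ne_zero h0⟩)
    unfold boundaryWeight
    rw [sum_add_distrib, h1, h2, card_eq_sum_ones]
  have hpred : ∑ u ∈ T, (t u - 1) + #T = ∑ u ∈ T, t u := by
    rw [card_eq_sum_ones, ← sum_add_distrib]
    exact sum_congr rfl fun u hu => Nat.sub_add_cancel (mem_filter.1 hu).2
  have hx : ∀ x ∈ B, d - 2 ≤ ∑ u ∈ G.neighborFinset x, (t u - 1) := by
    intro x hx
    rw [hB, mem_filter, mem_compl, ht, card_eq_zero] at hx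
    have h1 := hbad x hx.1 fun u hu huP => by
      have : u ∈ G.neighborFinset x ∩ P := by simpa using ⟨hu, huP⟩
      rw [hx.2] at this
      simp at this
    have h2 : ∑ u ∈ G.neighborFinset x, t u ≤ ∑ u ∈ G.neighborFinset x, ((t u - 1) + 1) :=
      sum_le_sum fun u _ => by omega
    rw [sum_add_distrib, ← card_eq_sum_ones, card_neighborFinset_eq_degree, hreg x] at h2
    simp only [ht] at h1 h2 ⊢
    omega
  have hdouble : ∑ x ∈ B, ∑ u ∈ G.neighborFinset x, (t u - 1) =
      ∑ u, #(G.neighborFinset u ∩ B) * (t u - 1) := by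
    rw [sum_comm' (s' := fun u => G.neighborFinset u ∩ B) (t' := univ)]
    · simp
    · intro x u
      simp [G.adj_comm, and_comm]
  have hu : ∀ u, #(G.neighborFinset u ∩ B) * (t u - 1) ≤
      if u ∈ T then (d - 2) * (t u - 1) else 0 := by
    intro u
    split_ifs with huT
    · by_cases h1 : t u = 1
      · simp [h1]
      · gcongr
        have hpos := (mem_filter.1 huT).2
        have hdis : Disjoint (G.neighborFinset u ∩ B) (G.neighborFinset u ∩ P) := by
          refine Finset.disjoint_left.2 fun w hw hw' => ?_
          have := (mem_filter.1 (mem_inter.1 hw).2).1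
          exact (mem_compl.1 this) (mem_inter.1 hw').2
        have := card_le_card (union_subset (inter_subset_left (s₁ := G.neighborFinset u) (s₂ := B))
          (inter_subset_left (s₁ := G.neighborFinset u) (s₂ := P)))
        rw [card_union_of_disjoint hdis, card_neighborFinset_eq_degree, hreg u] at this
        simp only [ht] at h1 hpos
        omega
    · rw [Nat.le_zero, mul_eq_zero]
      by_cases huP : u ∈ P
      · left
        rw [card_eq_zero, eq_empty_iff_forall_notMem]
        intro w hw
        rw [mem_inter, mem_neighborFinset, hB, mem_filter, ht, card_eq_zero] at hw
        have : u ∈ G.neighborFinset w ∩ P := by simpa using ⟨hw.1.symm, huP⟩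
        rw [hw.2.2] at this
        simp at this
      · right
        have : ¬ 0 < t u := fun h => huT (mem_filter.2 ⟨mem_compl.2 huP, h⟩)
        omega
  have hsum : (d - 2) * #B ≤ (d - 2) * ∑ u ∈ T, (t u - 1) := by
    calc (d - 2) * #B ≤ ∑ x ∈ B, ∑ u ∈ G.neighborFinset x, (t u - 1) := by
          rw [mul_comm, ← smul_eq_mul]; exact card_nsmul_le_sum _ _ _ hx
      _ ≤ ∑ u, if u ∈ T then (d - 2) * (t u - 1) else 0 := by
          rw [hdouble]; exact sum_le_sum fun u _ => hu u
      _ = (d - 2) * ∑ u ∈ T, (t u - 1) := by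
          rw [sum_ite_mem, univ_inter, mul_sum]
  have := Nat.le_of_mul_le_mul_left hsum (by omega)
  omega

theorem IsPartialBColoring.exists_union_closedNeighborFinset
    (hreg : G.IsRegularOfDegree d)
    (hC4 : ∀ a b x y, a ≠ b → G.Adj a x → G.Adj a y → G.Adj b x → G.Adj b y → x = y)
    {k : ℕ} {P : Finset V} {c : V → Fin (d + 1)} {v : Fin (d + 1) → V}
    (h : G.IsPartialBColoring k P c v) (hk : k ≤ d) {x : V} (hxP : x ∉ P)
    (hxN : ∀ u, G.Adj x u → u ∉ P)
    (hfew : ∑ u ∈ G.neighborFinset x, #(G.neighborFinset u ∩ P) + 3 ≤ 2 * d) :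
    ∃ (c' : V → Fin (d + 1)) (v' : Fin (d + 1) → V),
      G.IsPartialBColoring (k + 1) (P ∪ G.closedNeighborFinset x) c' v' := by
  classical
  set k₀ : Fin (d + 1) := ⟨k, by omega⟩ with hk₀
  set F : V → Fin (d + 1) → Prop := fun u b => ∃ s ∈ P, G.Adj u s ∧ c s = b with hF
  have hrow : ∀ u, #{b ∈ univ.erase k₀ | F u b} ≤ #(G.neighborFinset u ∩ P) := by
    intro u
    refine le_trans (card_le_card fun b hb => ?_) (card_image_le (f := c))
    obtain ⟨s, hs, hus, rfl⟩ := (mem_filter.1 hb).2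
    exact mem_image_of_mem _ (by simpa using ⟨hus, hs⟩)
  obtain ⟨f, hfinj, hf⟩ := exists_injOn_avoiding (d := d) (G.neighborFinset x) (univ.erase k₀) F
    (by rw [card_neighborFinset_eq_degree, hreg x]) (by simp)
    (by
      intro u hu
      refine (hrow u).trans_lt ?_
      rw [← hreg u, ← card_neighborFinset_eq_degree]
      refine card_lt_card ⟨inter_subset_left, fun hs => hxP ?_⟩
      exact (mem_inter.1 (hs ((G.mem_neighborFinset u x).2
        ((G.mem_neighborFinset x u).1 hu).symm))).2)
    (by
      intro b hb
      have hex : ∀ u ∈ ({u ∈ G.neighborFinset x | F u b} : Finset V),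
          ∃ i : Fin (d + 1), i.val < k ∧ ∃ s, c s = b ∧ G.Adj u s ∧ G.Adj (v i) s ∧ s ∈ P := by
        intro u hu
        obtain ⟨hux, s, hs, hus, hsb⟩ := mem_filter.1 hu
        obtain ⟨i, hi, hsi⟩ := h.cover s hs
        refine ⟨i, hi, s, hsb, hus, hsi.resolve_left ?_, hs⟩
        rintro rfl
        exact hxN u ((G.mem_neighborFinset x u).1 hux) (h.closed i hi u hus.symm)
      choose! g hg s hs using hex
      have hcol := card_le_card_of_injOn (s := {u ∈ G.neighborFinset x | F u b})
        (t := ({i : Fin (d + 1) | i.val < k} : Finset _).erase b) g (by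
          intro u hu
          obtain ⟨h1, h2, h3, h4⟩ := hs u hu
          simp only [coe_erase, coe_filter, mem_univ, true_and, Set.mem_sdiff, Set.mem_ofPred_eq,
            Set.mem_singleton_iff]
          refine ⟨hg u hu, fun hb => ?_⟩
          have := h.proper _ (h.mem _ (hg u hu)) _ h4 h3
          rw [h.color _ (hg u hu), h1] at this
          exact this hb) (by
          intro u hu u' hu' huu
          obtain ⟨h1, h2, h3, h4⟩ := hs u hu
          obtain ⟨h1', h2', h3', h4'⟩ := hs u' hu'
          rw [← huu] at h3'
          have hss : s u = s u' := h.injOn _ (hg u hu) h3 h3' (h1.trans h1'.symm)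
          rw [← hss] at h2'
          refine hC4 x (s u) u u' ?_ ((G.mem_neighborFinset x u).1 (mem_filter.1 hu).1)
            ((G.mem_neighborFinset x u').1 (mem_filter.1 hu').1) h2.symm h2'.symm
          rintro hxs
          exact hxP (hxs ▸ h4))
      refine hcol.trans_lt ?_
      have hck : #({i : Fin (d + 1) | i.val < k} : Finset _) = k := by
        rw [Fin.card_filter_val_lt]; omega
      have hbk : b.val ≠ k := fun hbk => (mem_erase.1 hb).1 (Fin.ext hbk)
      have hb2 := b.2
      by_cases hbk' : b.val < k
      · rw [card_erase_of_mem (by simpa using hbk'), hck]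
        omega
      · rw [erase_eq_of_notMem (by simpa using hbk'), hck]
        omega)
    (by
      have := sum_le_sum fun u (_ : u ∈ G.neighborFinset x) => hrow u
      omega)
  have hf1 : ∀ u, G.Adj x u → f u ≠ k₀ := fun u hu =>
    (mem_erase.1 (hf u ((G.mem_neighborFinset x u).2 hu)).1).1
  have hf2 : ∀ u, G.Adj x u → ∀ s ∈ P, G.Adj u s → c s ≠ f u := fun u hu s hs hus hc =>
    (hf u ((G.mem_neighborFinset x u).2 hu)).2 ⟨s, hs, hus, hc⟩
  have hf3 : ∀ u w, G.Adj x u → G.Adj x w → f u = f w → u = w := fun u w hu hw huw =>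
    hfinj (by simpa using hu) (by simpa using hw) huw
  set c' : V → Fin (d + 1) := fun u => if u ∈ P then c u else if u = x then k₀ else f u with hc'
  have hcP : ∀ u ∈ P, c' u = c u := fun u hu => by simp [hc', hu]
  have hcx : c' x = k₀ := by simp [hc', hxP]
  have hcf : ∀ u, G.Adj x u → c' u = f u := fun u hu => by simp [hc', hxN u hu, hu.ne']
  have hv : ∀ i : Fin (d + 1), i.val < k → Function.update v k₀ x i = v i := fun i hi =>
    Function.update_of_ne (fun hik => by simp [hik, hk₀] at hi) _ _
  have hcase : ∀ i : Fin (d + 1), i.val < k + 1 → i = k₀ ∨ i.val < k := fun i hi => by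
    rw [Fin.ext_iff]; simp only [hk₀]; omega
  refine ⟨c', Function.update v k₀ x, ⟨?_, ?_, ?_, ?_, ?_, ?_⟩⟩
  · intro u hu w hw huw
    rw [mem_union, mem_closedNeighborFinset] at hu hw
    rcases hu with hu | rfl | hu <;> rcases hw with hw | rfl | hw
    · rw [hcP u hu, hcP w hw]; exact h.proper u hu w hw huw
    · exact absurd hu (hxN u huw.symm)
    · rw [hcP u hu, hcf w hw]; exact hf2 w hw u hu huw.symm
    · exact absurd hw (hxN w huw)
    · exact absurd rfl huw.ne
    · rw [hcx, hcf w hw]; exact (hf1 w hw).symm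
    · rw [hcP w hw, hcf u hu]; exact (hf2 u hu w hw huw).symm
    · rw [hcx, hcf u hu]; exact hf1 u hu
    · rw [hcf u hu, hcf w hw]; exact fun he => huw.ne (hf3 u w hu hw he)
  · intro i hi
    rcases hcase i hi with rfl | hi
    · simp [mem_closedNeighborFinset]
    · rw [hv i hi]; exact mem_union_left _ (h.mem i hi)
  · intro i hi
    rcases hcase i hi with rfl | hi
    · simp [hcx]
    · rw [hv i hi, hcP _ (h.mem i hi), h.color i hi]
  · intro i hi w hw
    rcases hcase i hi with rfl | hi
    · rw [Function.update_self] at hw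
      exact mem_union_right _ (mem_closedNeighborFinset.2 (Or.inr hw))
    · rw [hv i hi] at hw
      exact mem_union_left _ (h.closed i hi w hw)
  · intro i hi u hu w hw huw
    rcases hcase i hi with rfl | hi
    · rw [Function.update_self] at hu hw
      rw [hcf u hu, hcf w hw] at huw
      exact hf3 u w hu hw huw
    · rw [hv i hi] at hu hw
      rw [hcP u (h.closed i hi u hu), hcP w (h.closed i hi w hw)] at huw
      exact h.injOn i hi hu hw huw
  · intro s hs
    rw [mem_union, mem_closedNeighborFinset] at hs
    rcases hs with hs | hs
    · obtain ⟨i, hi, his⟩ := h.cover s hs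
      exact ⟨i, by omega, by rwa [hv i hi]⟩
    · exact ⟨k₀, by simp [hk₀], by simpa using hs⟩

theorem exists_isPartialBColoring_closedNeighborFinset (hd : 2 ≤ d) (hreg : G.IsRegularOfDegree d)
    (hC4 : ∀ a b x y, a ≠ b → G.Adj a x → G.Adj a y → G.Adj b x → G.Adj b y → x = y) (x : V) :
    ∃ (c : V → Fin (d + 1)) (v : Fin (d + 1) → V),
      G.IsPartialBColoring 1 (G.closedNeighborFinset x) c v := by
  have h : G.IsPartialBColoring 0 ∅ (fun _ => (0 : Fin (d + 1))) (fun _ => x) :=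
    ⟨by simp, by simp, by simp, by simp, by simp, by simp⟩
  simpa using h.exists_union_closedNeighborFinset hreg hC4 (Nat.zero_le d) (x := x) (by simp)
    (by simp) (by simp; omega)

/-- In a triangle-free graph without 4-cycles, two adjacent vertices can be made dominant. -/
theorem exists_isPartialBColoring_of_adj (hd : 3 ≤ d) (hreg : G.IsRegularOfDegree d)
    (hC4 : ∀ a b x y, a ≠ b → G.Adj a x → G.Adj a y → G.Adj b x → G.Adj b y → x = y)
    (htri : ∀ x y z, G.Adj x y → G.Adj x z → ¬ G.Adj y z) {p q : V} (hpq : G.Adj p q) :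
    ∃ (c : V → Fin (d + 1)) (v : Fin (d + 1) → V),
      G.IsPartialBColoring 2 (G.closedNeighborFinset p ∪ G.closedNeighborFinset q) c v := by
  classical
  have hex : ∀ a b : V, G.Adj a b → ∃ f : V → Fin (d + 1),
      (∀ u w, G.Adj a u → u ≠ b → G.Adj a w → w ≠ b → f u = f w → u = w) ∧
      ∀ u, G.Adj a u → u ≠ b → f u ≠ 0 ∧ f u ≠ 1 := by
    intro a b hab
    have h01 : (1 : Fin (d + 1)) ≠ 0 := by
      rw [Ne, Fin.ext_iff, Fin.val_one', Fin.val_zero, Nat.mod_eq_of_lt] <;> omega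
    obtain ⟨f, hf, hf'⟩ := exists_injOn_avoiding (d := d - 1) ((G.neighborFinset a).erase b)
      ((univ.erase (0 : Fin (d + 1))).erase 1) (fun _ _ => False)
      (by rw [card_erase_of_mem (by simpa using hab), card_neighborFinset_eq_degree, hreg a])
      (by rw [card_erase_of_mem (by simpa using h01), card_erase_of_mem (mem_univ _)]; simp)
      (by simp; omega) (by simp; omega) (by simp; omega)
    refine ⟨f, fun u w hu hub hw hwb huw => hf (by simp [hu, hub]) (by simp [hw, hwb]) huw,
      fun u hu hub => ?_⟩
    simpa [and_comm] using (hf' u (by simp [hu, hub])).1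
  obtain ⟨f, hf, hf'⟩ := hex p q hpq
  obtain ⟨g, hg, hg'⟩ := hex q p hpq.symm
  set c : V → Fin (d + 1) := fun u =>
    if u = p then 0 else if u = q then 1 else if G.Adj p u then f u else g u with hc
  have h1 : (1 : Fin (d + 1)).val = 1 := by
    rw [Fin.val_one', Nat.mod_eq_of_lt]; omega
  have h01 : (0 : Fin (d + 1)) ≠ 1 := by rw [Ne, Fin.ext_iff, h1]; simp
  have hcp : c p = 0 := by simp [hc]
  have hcq : c q = 1 := by simp [hc, hpq.ne']
  have hcf : ∀ u, G.Adj p u → u ≠ q → c u = f u := fun u hu huq => by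
    simp [hc, hu.ne', huq, hu]
  have hcg : ∀ u, G.Adj q u → u ≠ p → c u = g u := fun u hu hup => by
    have hpu : ¬ G.Adj p u := fun h => htri p q u hpq h hu
    simp [hc, hu.ne', hup, hpu]
  have hP : ∀ u, u ∈ G.closedNeighborFinset p ∪ G.closedNeighborFinset q →
      u = p ∨ u = q ∨ (G.Adj p u ∧ u ≠ q) ∨ (G.Adj q u ∧ u ≠ p) := by
    intro u hu
    rw [mem_union, mem_closedNeighborFinset, mem_closedNeighborFinset] at hu
    tauto
  have hinjp : Set.InjOn c (G.neighborSet p) := by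
    intro u hu w hw huw
    rw [mem_neighborSet] at hu hw
    by_cases huq : u = q <;> by_cases hwq : w = q
    · rw [huq, hwq]
    · rw [huq, hcq, hcf w hw hwq] at huw
      exact absurd huw.symm (hf' w hw hwq).2
    · rw [hwq, hcq, hcf u hu huq] at huw
      exact absurd huw (hf' u hu huq).2
    · rw [hcf u hu huq, hcf w hw hwq] at huw
      exact hf u w hu huq hw hwq huw
  have hinjq : Set.InjOn c (G.neighborSet q) := by
    intro u hu w hw huw
    rw [mem_neighborSet] at hu hw
    by_cases hup : u = p <;> by_cases hwp : w = p
    · rw [hup, hwp]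
    · rw [hup, hcp, hcg w hw hwp] at huw
      exact absurd huw.symm (hg' w hw hwp).1
    · rw [hwp, hcp, hcg u hu hup] at huw
      exact absurd huw (hg' u hu hup).1
    · rw [hcg u hu hup, hcg w hw hwp] at huw
      exact hg u w hu hup hw hwp huw
  have hcase : ∀ i : Fin (d + 1), i.val < 2 → i = 0 ∨ i = 1 := fun i hi => by
    rw [Fin.ext_iff, Fin.ext_iff, h1, Fin.val_zero]; omega
  refine ⟨c, fun i => if i = 0 then p else q, ⟨?_, ?_, ?_, ?_, ?_, ?_⟩⟩
  · intro u hu w hw huw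
    rcases hP u hu with rfl | rfl | hu | hu <;> rcases hP w hw with rfl | rfl | hw | hw
    · exact absurd rfl huw.ne
    · rw [hcp, hcq]; exact h01
    · rw [hcp, hcf w hw.1 hw.2]; exact (hf' w hw.1 hw.2).1.symm
    · rw [hcp, hcg w hw.1 hw.2]; exact (hg' w hw.1 hw.2).1.symm
    · rw [hcp, hcq]; exact h01.symm
    · exact absurd rfl huw.ne
    · rw [hcq, hcf w hw.1 hw.2]; exact (hf' w hw.1 hw.2).2.symm
    · rw [hcq, hcg w hw.1 hw.2]; exact (hg' w hw.1 hw.2).2.symm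
    · rw [hcp, hcf u hu.1 hu.2]; exact (hf' u hu.1 hu.2).1
    · rw [hcq, hcf u hu.1 hu.2]; exact (hf' u hu.1 hu.2).2
    · exact absurd huw (htri p u w hu.1 hw.1)
    · exact absurd (hC4 p w u q hw.2.symm hu.1 hpq huw.symm hw.1.symm) hu.2
    · rw [hcp, hcg u hu.1 hu.2]; exact (hg' u hu.1 hu.2).1
    · rw [hcq, hcg u hu.1 hu.2]; exact (hg' u hu.1 hu.2).2
    · exact absurd (hC4 p u w q hu.2.symm hw.1 hpq huw hu.1.symm) hw.2
    · exact absurd huw (htri q u w hu.1 hw.1)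
  · intro i hi
    rcases hcase i hi with rfl | rfl <;> simp [mem_closedNeighborFinset, h01.symm]
  · intro i hi
    rcases hcase i hi with rfl | rfl <;> simp [h01.symm, hcp, hcq]
  · intro i hi w hw
    rw [mem_union, mem_closedNeighborFinset, mem_closedNeighborFinset]
    rcases hcase i hi with rfl | rfl
    · rw [if_pos rfl] at hw; tauto
    · rw [if_neg h01.symm] at hw; tauto
  · intro i hi
    rcases hcase i hi with rfl | rfl
    · rwa [if_pos rfl]
    · rwa [if_neg h01.symm]
  · intro s hs
    rw [mem_union, mem_closedNeighborFinset, mem_closedNeighborFinset] at hs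
    rcases hs with hs | hs
    · exact ⟨0, by simp, by rwa [if_pos rfl]⟩
    · exact ⟨1, by omega, by rwa [if_neg h01.symm]⟩

theorem exists_proper_extension (hreg : G.IsRegularOfDegree d) {P : Finset V}
    {c : V → Fin (d + 1)} (h : ∀ u ∈ P, ∀ w ∈ P, G.Adj u w → c u ≠ c w) :
    ∃ c' : V → Fin (d + 1), (∀ u ∈ P, c' u = c u) ∧ ∀ u w, G.Adj u w → c' u ≠ c' w := by
  suffices H : ∀ Q : Finset V, ∃ c' : V → Fin (d + 1), (∀ u ∈ P, c' u = c u) ∧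
      ∀ u ∈ P ∪ Q, ∀ w ∈ P ∪ Q, G.Adj u w → c' u ≠ c' w by
    obtain ⟨c', h1, h2⟩ := H univ
    exact ⟨c', h1, fun u w => h2 u (by simp) w (by simp)⟩
  intro Q
  induction Q using Finset.induction_on with
  | empty => exact ⟨c, fun _ _ => rfl, by simpa using h⟩
  | insert a Q _ ih =>
    obtain ⟨c', h1, h2⟩ := ih
    by_cases haP : a ∈ P
    · refine ⟨c', h1, ?_⟩
      rwa [union_insert, insert_eq_of_mem (mem_union_left _ haP)]
    · obtain ⟨b, -, hb⟩ := exists_mem_notMem_of_card_lt_card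
        (s := (G.neighborFinset a).image c') (t := univ) (by
          refine card_image_le.trans_lt ?_
          rw [card_neighborFinset_eq_degree, hreg a]
          simp)
      have hb' : ∀ u, G.Adj a u → c' u ≠ b := fun u hu hub =>
        hb (mem_image.2 ⟨u, by simpa using hu, hub⟩)
      refine ⟨Function.update c' a b, fun u hu => ?_, ?_⟩
      · rw [Function.update_of_ne (by rintro rfl; exact haP hu), h1 u hu]
      · intro u hu w hw huw
        rw [union_insert, mem_insert] at hu hw
        by_cases hua : u = a
        · subst hua
          rw [Function.update_self, Function.update_of_ne huw.ne']
          exact (hb' w huw).symm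
        · by_cases hwa : w = a
          · subst hwa
            rw [Function.update_self, Function.update_of_ne hua]
            exact hb' u huw.symm
          · rw [Function.update_of_ne hua, Function.update_of_ne hwa]
            exact h2 u (hu.resolve_left hua) w (hw.resolve_left hwa) huw

theorem IsPartialBColoring.exists_isBColoring (hreg : G.IsRegularOfDegree d) {P : Finset V}
    {c : V → Fin (d + 1)} {v : Fin (d + 1) → V} (h : G.IsPartialBColoring (d + 1) P c v) :
    ∃ c' : V → Fin (d + 1), IsBColoring G (d + 1) c' := by
  obtain ⟨c', h1, h2⟩ := exists_proper_extension hreg h.proper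
  refine ⟨c', h2, fun i => ⟨v i, ?_, fun j hj => ?_⟩⟩
  · rw [h1 _ (h.mem i i.2), h.color i i.2]
  · have himg : (G.neighborFinset (v i)).image c' = univ.erase i := by
      refine eq_of_subset_of_card_le (fun b hb => ?_) ?_
      · obtain ⟨w, hw, rfl⟩ := mem_image.1 hb
        have := h2 _ _ ((G.mem_neighborFinset _ _).1 hw)
        rw [h1 _ (h.mem i i.2), h.color i i.2] at this
        simpa using this.symm
      · rw [card_image_of_injOn, card_neighborFinset_eq_degree, hreg (v i)]
        · simp
        · intro u hu w hw huw
          rw [mem_coe, mem_neighborFinset] at hu hw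
          rw [h1 u (h.closed i i.2 u hu), h1 w (h.closed i i.2 w hw)] at huw
          exact h.injOn i i.2 hu hw huw
    have : j ∈ (G.neighborFinset (v i)).image c' := by rw [himg]; simpa using hj
    obtain ⟨w, hw, hwj⟩ := mem_image.1 this
    exact ⟨w, (G.mem_neighborFinset _ _).1 hw, hwj⟩

theorem exists_isPartialBColoring_of_slack (hd : 3 ≤ d) (hreg : G.IsRegularOfDegree d)
    (hC4 : ∀ a b x y, a ≠ b → G.Adj a x → G.Adj a y → G.Adj b x → G.Adj b y → x = y)
    (hcard : d ^ 3 + d ≤ Fintype.card V) {k₀ : ℕ}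
    (h : ∃ P c v, G.IsPartialBColoring (d := d) k₀ P c v ∧
      G.boundaryWeight P < k₀ * (d ^ 2 + 1)) {k : ℕ} (hk₀ : k₀ ≤ k) (hk : k ≤ d + 1) :
    ∃ P c v, G.IsPartialBColoring (d := d) k P c v ∧ G.boundaryWeight P < k * (d ^ 2 + 1) := by
  induction k, hk₀ using Nat.le_induction with
  | base => exact h
  | succ k _ ih =>
    obtain ⟨P, c, v, hP, hw⟩ := ih (by omega)
    have hkd : k * (d ^ 2 + 1) ≤ d ^ 3 + d := by
      calc k * (d ^ 2 + 1) ≤ d * (d ^ 2 + 1) := Nat.mul_le_mul_right _ (by omega)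
        _ = d ^ 3 + d := by ring
    obtain ⟨x, hxP, hxN, hfew⟩ := exists_far_vertex hd hreg P (by omega)
    obtain ⟨c', v', h'⟩ := hP.exists_union_closedNeighborFinset hreg hC4 (by omega) hxP hxN hfew
    refine ⟨_, c', v', h', ?_⟩
    have h1 := boundaryWeight_union_add_card_inter_le (G := G) P (G.closedNeighborFinset x)
    have h2 := boundaryWeight_closedNeighborFinset_le hreg x
    rw [add_mul, one_mul]
    omega

theorem exists_isPartialBColoring_lt (hd : 3 ≤ d) (hreg : G.IsRegularOfDegree d)
    (hC4 : ∀ a b x y, a ≠ b → G.Adj a x → G.Adj a y → G.Adj b x → G.Adj b y → x = y)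
    [Nonempty V] :
    ∃ k₀ ≤ d, ∃ P c v, G.IsPartialBColoring (d := d) k₀ P c v ∧
      G.boundaryWeight P < k₀ * (d ^ 2 + 1) := by
  by_cases htri : ∃ x y z, G.Adj x y ∧ G.Adj x z ∧ G.Adj y z
  · obtain ⟨x, y, z, hxy, hxz, hyz⟩ := htri
    obtain ⟨c, v, h⟩ := exists_isPartialBColoring_closedNeighborFinset (by omega) hreg hC4 x
    exact ⟨1, by omega, _, c, v, h, by
      simpa using boundaryWeight_closedNeighborFinset_lt hreg hxy hxz hyz⟩
  · push Not at htri
    obtain ⟨p⟩ := ‹Nonempty V›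
    obtain ⟨q, hpq⟩ : ∃ q, G.Adj p q := by
      rw [← G.degree_pos_iff_exists_adj, hreg p]; omega
    obtain ⟨c, v, h⟩ := exists_isPartialBColoring_of_adj hd hreg hC4 htri hpq
    refine ⟨2, by omega, _, c, v, h, ?_⟩
    have h1 := boundaryWeight_union_add_card_inter_le (G := G) (G.closedNeighborFinset p)
      (G.closedNeighborFinset q)
    have h2 := boundaryWeight_closedNeighborFinset_le hreg p
    have h3 := boundaryWeight_closedNeighborFinset_le hreg q
    have h4 : 0 < #(G.closedNeighborFinset p ∩ G.closedNeighborFinset q) :=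
      card_pos.2 ⟨p, by simp [mem_closedNeighborFinset, hpq.symm]⟩
    omega

end SimpleGraph

/-- Theorem 2.1: a `d`-regular graph (`d ≥ 4`) with no cycle of order 4 and at least
`d³ + d` vertices has b-chromatic number `d + 1`. -/
theorem bChromaticNumber_eq_of_no_C4
    {V : Type*} [Fintype V] (G : SimpleGraph V) [DecidableRel G.Adj]
    (d : ℕ) (hd : 4 ≤ d) (hreg : G.IsRegularOfDegree d)
    (hC4 : ¬ ∃ a b c e : V, a ≠ b ∧ a ≠ c ∧ a ≠ e ∧ b ≠ c ∧ b ≠ e ∧ c ≠ e ∧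
      G.Adj a b ∧ G.Adj b c ∧ G.Adj c e ∧ G.Adj e a)
    (hcard : d ^ 3 + d ≤ Fintype.card V) :
    bChromaticNumber G = d + 1 := by
  classical
  have hC4' : ∀ a b x y, a ≠ b → G.Adj a x → G.Adj a y → G.Adj b x → G.Adj b y → x = y := by
    intro a b x y hab hax hay hbx hby
    by_contra hxy
    exact hC4 ⟨a, x, b, y, hax.ne, hab, hay.ne, hbx.ne', hxy, hby.ne, hax, hbx.symm, hby, hay.symm⟩
  have : Nonempty V := Fintype.card_pos_iff.1 (by omega)
  obtain ⟨k₀, hk₀, h⟩ := SimpleGraph.exists_isPartialBColoring_lt (by omega) hreg hC4'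
  obtain ⟨P, c, v, hP, -⟩ := SimpleGraph.exists_isPartialBColoring_of_slack (by omega) hreg hC4'
    hcard h (Nat.le_succ_of_le hk₀) le_rfl
  refine IsGreatest.csSup_eq ⟨hP.exists_isBColoring hreg, ?_⟩
  rintro k ⟨c', hc'⟩
  exact SimpleGraph.le_of_isBColoring hreg hc'
end

section
/- Let d ≥ 4 and let G be a finite d-regular simple graph of girth at least 5 (equivalently, d-regular with no cycle of order 3 and no cycle of order 4). If G has at least d³ + d vertices, then the b-chromatic number of G equals d + 1. In particular, the conjecture of El Sahili and Kouider (that every d-regular graph with girth 5 and d ≥ 4 satisfies b(G) = d + 1) holds for all such graphs having at least d³ + d vertices. -/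
theorem eq_of_two_common_neighbors {V : Type*} (G : SimpleGraph V)
    (hgirth : (5 : ℕ∞) ≤ G.girth) {u v x y : V} (hux : G.Adj u x) (huy : G.Adj u y)
    (hvx : G.Adj v x) (hvy : G.Adj v y) (huv : u ≠ v) : x = y := by
  by_contra hxy
  have hg : 5 ≤ G.girth := by exact_mod_cast hgirth
  have hc : (SimpleGraph.Walk.cons hux
      (.cons hvx.symm (.cons hvy (.cons huy.symm .nil)))).IsCycle := by
    rw [SimpleGraph.Walk.isCycle_def]
    have := hux.ne; have := huy.ne; have := hvx.ne; have := hvy.ne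
    simp [SimpleGraph.Walk.isTrail_def]
    grind
  have := hc.girth_le_length
  simp at this
  omega

theorem not_adj_of_common_neighbor {V : Type*} (G : SimpleGraph V)
    (hgirth : (5 : ℕ∞) ≤ G.girth) {u v x : V} (hux : G.Adj u x) (hvx : G.Adj v x) :
    ¬ G.Adj u v := by
  intro huv
  have hg : 5 ≤ G.girth := by exact_mod_cast hgirth
  have hc : (SimpleGraph.Walk.cons hux (.cons hvx.symm (.cons huv.symm .nil))).IsCycle := by
    rw [SimpleGraph.Walk.isCycle_def]
    have := hux.ne; have := huv.ne; have := hvx.ne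
    simp [SimpleGraph.Walk.isTrail_def]
    grind
  have := hc.girth_le_length
  simp at this
  omega

theorem le_of_isBColoring {V : Type*} [Fintype V] (G : SimpleGraph V) [DecidableRel G.Adj]
    {d k : ℕ} (hreg : G.IsRegularOfDegree d) {c : V → Fin k} (hc : IsBColoring G k c) :
    k ≤ d + 1 := by
  classical
  rcases Nat.eq_zero_or_pos k with rfl | hk
  · omega
  obtain ⟨v, hv, hdom⟩ := hc.2 ⟨0, hk⟩
  have hsub : Finset.univ.erase (⟨0, hk⟩ : Fin k) ⊆ (G.neighborFinset v).image c := by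
    intro j hj
    obtain ⟨w, hw, rfl⟩ := hdom j (Finset.ne_of_mem_erase hj)
    exact Finset.mem_image_of_mem c (by simpa using hw)
  have h := (Finset.card_le_card hsub).trans Finset.card_image_le
  rw [Finset.card_erase_of_mem (Finset.mem_univ _), Finset.card_univ, Fintype.card_fin,
    G.card_neighborFinset_eq_degree, hreg v] at h
  omega

theorem exists_proper_extension {V : Type*} [Fintype V] (G : SimpleGraph V) [DecidableRel G.Adj]
    {d : ℕ} (hreg : G.IsRegularOfDegree d) (S : Finset V) (c : V → Fin (d + 1))
    (hc : ∀ u ∈ S, ∀ w ∈ S, G.Adj u w → c u ≠ c w) :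
    ∃ c' : V → Fin (d + 1), (∀ u ∈ S, c' u = c u) ∧ ∀ u w, G.Adj u w → c' u ≠ c' w := by
  classical
  suffices h : ∀ T : Finset V, ∃ c' : V → Fin (d + 1), (∀ u ∈ S, c' u = c u) ∧
      ∀ u ∈ S ∪ T, ∀ w ∈ S ∪ T, G.Adj u w → c' u ≠ c' w by
    obtain ⟨c', h1, h2⟩ := h Finset.univ
    exact ⟨c', h1, fun u w => h2 u (by simp) w (by simp)⟩
  intro T
  induction T using Finset.induction_on with
  | empty => exact ⟨c, by simp, by simpa using hc⟩
  | insert x T hx ih =>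
    obtain ⟨c', h1, h2⟩ := ih
    by_cases hxS : x ∈ S
    · refine ⟨c', h1, ?_⟩
      have : S ∪ insert x T = S ∪ T := by grind
      rwa [this]
    · obtain ⟨a, ha⟩ : ∃ a, a ∉ (G.neighborFinset x).image c' := by
        by_contra! hall
        have h := (Finset.card_le_card (fun a _ => hall a :
          (Finset.univ : Finset (Fin (d + 1))) ⊆ _)).trans Finset.card_image_le
        rw [Finset.card_univ, Fintype.card_fin, G.card_neighborFinset_eq_degree, hreg x] at h
        omega
      have ha' : ∀ w, G.Adj x w → c' w ≠ a := fun w hw h =>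
        ha (Finset.mem_image.2 ⟨w, by simpa using hw, h⟩)
      refine ⟨Function.update c' x a, fun u hu => ?_, fun u hu w hw huw => ?_⟩
      · rw [Function.update_of_ne (by rintro rfl; exact hxS hu), h1 u hu]
      · have hne := huw.ne
        rcases eq_or_ne u x with rfl | hux
        · rw [Function.update_self, Function.update_of_ne hne.symm]
          exact (ha' w huw).symm
        · rcases eq_or_ne w x with rfl | hwx
          · rw [Function.update_self, Function.update_of_ne hne]
            exact ha' u huw.symm
          · rw [Function.update_of_ne hux, Function.update_of_ne hwx]
            exact h2 u (by grind) w (by grind) huw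

/-- The neighbors of `v` in `S` whose color differs from `a`. -/
def coloredNeighbors {V : Type*} [DecidableEq V] (G : SimpleGraph V) [DecidableRel G.Adj]
    {k : ℕ} (S : Finset V) (c : V → Fin k) (a : Fin k) (v : V) : Finset V :=
  {w ∈ S | G.Adj v w ∧ c w ≠ a}

theorem sparse_weight_le {d s q o f : ℕ} (hd : 2 ≤ d) (hsplit : o + s + q = d)
    (hf : q = 0 → (s = 0 → 2 * d ≤ f + 2) ∧ (s = 1 → d ≤ f + 1)) :
    (2 * d - 2 : ℤ) * (1 - (s + q : ℕ)) ≤ f - (s * o : ℕ) := by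
  have hou : (o : ℤ) = d - s - q := by omega
  push_cast
  rw [hou]
  have hd' : (2 : ℤ) ≤ d := by exact_mod_cast hd
  have hfn : (0 : ℤ) ≤ f := by positivity
  have hsn : (0 : ℤ) ≤ s := by positivity
  rcases Nat.eq_zero_or_pos q with h0 | hpos
  · obtain ⟨hb0, hb1⟩ := hf h0
    rw [h0]
    obtain h | h | h : s = 0 ∨ s = 1 ∨ 2 ≤ s := by omega
    · have := hb0 h
      rw [h]; push_cast; zify at this; linarith
    · have := hb1 h
      rw [h]; push_cast; zify at this; linarith
    · have h' : (2 : ℤ) ≤ s := by exact_mod_cast h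
      push_cast
      nlinarith [mul_nonneg (sub_nonneg.2 h') (by linarith : (0 : ℤ) ≤ s + d)]
  · have h' : (1 : ℤ) ≤ q := by exact_mod_cast hpos
    have h1 : (s : ℤ) * (d - s - q) ≤ s * (2 * d - 2) :=
      mul_le_mul_of_nonneg_left (by linarith) hsn
    have h2 : (0 : ℤ) ≤ (2 * d - 2) * (q - 1) := mul_nonneg (by linarith) (by linarith)
    nlinarith

/-- If few edges leave `S`, some vertex `v ∉ S` without neighbors of color `a` in `S` has at most
one neighbor in `S`, and few paths of length two lead from `v` to `S`. -/
theorem exists_sparse_vertex {V : Type*} [Fintype V] [DecidableEq V] (G : SimpleGraph V)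
    [DecidableRel G.Adj] {d : ℕ} (hd : 2 ≤ d) (hreg : G.IsRegularOfDegree d) (S : Finset V)
    (c : V → Fin (d + 1)) (a : Fin (d + 1))
    (hS : S.card + ∑ w ∈ S, (G.neighborFinset w \ S).card < Fintype.card V) :
    ∃ v ∉ S, (∀ w ∈ S, G.Adj v w → c w ≠ a) ∧
      (((coloredNeighbors G S c a v).card = 0 ∧
        ∑ u ∈ G.neighborFinset v \ S, (coloredNeighbors G S c a u).card + 2 < 2 * d) ∨
       ((coloredNeighbors G S c a v).card = 1 ∧
        ∑ u ∈ G.neighborFinset v \ S, (coloredNeighbors G S c a u).card + 1 < d)) := by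
  by_contra! hbad
  set s : V → ℕ := fun v => (coloredNeighbors G S c a v).card with hs
  set f : V → ℕ := fun v => ∑ u ∈ G.neighborFinset v \ S, s u with hf
  set q : V → ℕ := fun v => ({w ∈ S | G.Adj v w ∧ c w = a} : Finset V).card with hq
  set o : V → ℕ := fun v => (G.neighborFinset v \ S).card with ho
  have hsplit : ∀ u, o u + s u + q u = d := by
    intro u
    have h1 : s u + q u = (G.neighborFinset u ∩ S).card := by
      rw [hs, hq]
      simp only [coloredNeighbors]
      rw [← Finset.card_union_of_disjoint]
      · congr 1; ext w; simp; tauto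
      · rw [Finset.disjoint_left]; intro w; simp; tauto
    have h2 := Finset.card_sdiff_add_card_inter (G.neighborFinset u) S
    rw [G.card_neighborFinset_eq_degree, hreg u] at h2
    simp only [ho]; omega
  have hdouble : ∀ A B : Finset V, ∀ g : V → ℕ,
      ∑ v ∈ A, ∑ u ∈ B with G.Adj v u, g u =
        ∑ u ∈ B, g u * ({v ∈ A | G.Adj u v} : Finset V).card := by
    intro A B g
    simp_rw [Finset.sum_filter]
    rw [Finset.sum_comm]
    refine Finset.sum_congr rfl fun u _ => ?_
    rw [← Finset.sum_filter, Finset.sum_const, smul_eq_mul, mul_comm]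
    simp_rw [G.adj_comm]
  have hout : ∀ v, G.neighborFinset v \ S = {u ∈ Sᶜ | G.Adj v u} := by
    intro v; ext u; simp; tauto
  have hfsum : ∑ v ∈ Sᶜ, f v = ∑ u ∈ Sᶜ, s u * o u := by
    simp only [hf, ho, hout]
    exact hdouble _ _ _
  have hesum : ∑ u ∈ Sᶜ, (s u + q u) = ∑ w ∈ S, o w := by
    have h := hdouble S Sᶜ (fun _ => 1)
    simp only [one_mul, Finset.sum_const, smul_eq_mul, mul_one] at h
    simp only [ho, hout]
    rw [h]
    refine Finset.sum_congr rfl fun u _ => ?_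
    simp only [hs, hq, coloredNeighbors]
    rw [← Finset.card_union_of_disjoint]
    · congr 1; ext w; simp; tauto
    · rw [Finset.disjoint_left]; intro w; simp; tauto
  have hpt : ∀ u ∈ Sᶜ, (2 * d - 2 : ℤ) * (1 - (s u + q u : ℕ)) ≤ f u - (s u * o u : ℕ) := by
    intro u hu
    refine sparse_weight_le hd (hsplit u) fun h0 => ?_
    obtain ⟨hb0, hb1⟩ := hbad u (Finset.mem_compl.1 hu) fun w hw huw hcw =>
      Finset.notMem_empty w (Finset.card_eq_zero.1 h0 ▸ Finset.mem_filter.2 ⟨hw, huw, hcw⟩)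
    exact ⟨hb0, hb1⟩
  have hsum := Finset.sum_le_sum hpt
  rw [← Finset.mul_sum, Finset.sum_sub_distrib, Finset.sum_sub_distrib, ← Nat.cast_sum,
    ← Nat.cast_sum, ← Nat.cast_sum, hfsum, hesum, sub_self] at hsum
  have hcc := Finset.card_add_card_compl S
  have hpos : (0 : ℤ) < (∑ _u ∈ Sᶜ, 1) - (∑ w ∈ S, o w : ℕ) := by
    simp only [Finset.sum_const, nsmul_eq_mul, mul_one]
    have : S.card + ∑ w ∈ S, o w < Fintype.card V := hS
    zify at this hcc ⊢
    linarith
  have hd' : (0 : ℤ) < 2 * d - 2 := by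
    have : (2 : ℤ) ≤ d := by exact_mod_cast hd
    linarith
  exact absurd hsum (not_le.2 (mul_pos hd' hpos))

/-- A proper coloring `c` of the vertices of `S` in which each color `a ∈ D` has a center `z a`
whose closed neighborhood lies in `S` and whose neighbors have pairwise distinct colors, and in
which `S` is the union of these closed neighborhoods. -/
structure IsPartialBColoring {V : Type*} (G : SimpleGraph V) {k : ℕ} (D : Finset (Fin k))
    (z : Fin k → V) (S : Finset V) (c : V → Fin k) : Prop where
  proper : ∀ u ∈ S, ∀ w ∈ S, G.Adj u w → c u ≠ c w
  center_mem : ∀ a ∈ D, z a ∈ S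
  center_color : ∀ a ∈ D, c (z a) = a
  neighbor_mem : ∀ a ∈ D, ∀ w, G.Adj (z a) w → w ∈ S
  neighbor_inj : ∀ a ∈ D, ∀ w w', G.Adj (z a) w → G.Adj (z a) w' → c w = c w' → w = w'
  cover : ∀ u ∈ S, ∃ a ∈ D, u = z a ∨ G.Adj (z a) u

namespace IsPartialBColoring

/-- If `a` has no center, at most `d - 1` neighbors of `v ∉ S` see a given color `b ≠ a` in `S`. -/
theorem card_lt_of_forall_adj_color {V : Type*} {G : SimpleGraph V} {d : ℕ}
    {D : Finset (Fin (d + 1))} {z : Fin (d + 1) → V} {S : Finset V} {c : V → Fin (d + 1)}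
    (h : IsPartialBColoring G D z S c) (hgirth : (5 : ℕ∞) ≤ G.girth) {a b : Fin (d + 1)}
    (ha : a ∉ D) (hb : b ≠ a) {v : V}
    (hv : v ∉ S) {X : Finset V} (hXv : ∀ x ∈ X, G.Adj v x) (hXS : ∀ x ∈ X, x ∉ S)
    (hX : ∀ x ∈ X, ∃ w ∈ S, G.Adj x w ∧ c w = b) : X.card < d := by
  have hex : ∀ x ∈ X, ∃ e ∈ D, e ≠ b ∧ ∃ w ∈ S, G.Adj x w ∧ G.Adj (z e) w ∧ c w = b := by
    intro x hx
    obtain ⟨w, hw, hxw, hwb⟩ := hX x hx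
    obtain ⟨e, he, rfl | hew⟩ := h.cover w hw
    · exact absurd (h.neighbor_mem e he x hxw.symm) (hXS x hx)
    · refine ⟨e, he, ?_, w, hw, hxw, hew, hwb⟩
      rintro rfl
      exact h.proper _ (h.center_mem e he) w hw hew (by rw [h.center_color e he, hwb])
  choose! e heD heb w hwS hxw hew hwb using hex
  have hcard : X.card ≤ ((Finset.univ.erase a).erase b).card := by
    refine Finset.card_le_card_of_injOn e (fun x hx => ?_) fun x hx y hy hxy => ?_
    · simp only [Finset.coe_erase, Set.mem_sdiff, Set.mem_singleton_iff, Finset.coe_univ,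
        Set.mem_univ, true_and]
      exact ⟨fun hea => ha (hea ▸ heD x hx), heb x hx⟩
    · have hww : w x = w y := h.neighbor_inj (e x) (heD x hx) _ _ (hew x hx)
        (hxy ▸ hew y hy) ((hwb x hx).trans (hwb y hy).symm)
      exact eq_of_two_common_neighbors G hgirth (hXv x hx) (hXv y hy) (hxw x hx).symm
        (hww ▸ (hxw y hy).symm) fun hvw => hv (hvw ▸ hwS x hx)
  rw [Finset.card_erase_of_mem (by simp [hb]), Finset.card_erase_of_mem (Finset.mem_univ _),
    Finset.card_univ, Fintype.card_fin] at hcard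
  have : 0 < d := by
    have := a.2; have := b.2
    by_contra h0
    exact hb (Fin.ext (by omega))
  omega

theorem exists_isBColoring {V : Type*} [Fintype V] {G : SimpleGraph V} [DecidableRel G.Adj] {d : ℕ}
    {z : Fin (d + 1) → V} {S : Finset V} {c : V → Fin (d + 1)}
    (h : IsPartialBColoring G Finset.univ z S c) (hreg : G.IsRegularOfDegree d) :
    ∃ c' : V → Fin (d + 1), IsBColoring G (d + 1) c' := by
  obtain ⟨c', hcS, hc'⟩ := exists_proper_extension G hreg S c h.proper
  refine ⟨c', hc', fun a => ⟨z a, ?_, fun b hb => ?_⟩⟩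
  · rw [hcS _ (h.center_mem a (Finset.mem_univ a)), h.center_color a (Finset.mem_univ a)]
  · have hza : c' (z a) = a := by
      rw [hcS _ (h.center_mem a (Finset.mem_univ a)), h.center_color a (Finset.mem_univ a)]
    have hinj : Set.InjOn c' (G.neighborFinset (z a)) := by
      intro w hw w' hw' hww
      have hw : G.Adj (z a) w := by simpa using hw
      have hw' : G.Adj (z a) w' := by simpa using hw'
      rw [hcS w (h.neighbor_mem a (Finset.mem_univ a) w hw),
        hcS w' (h.neighbor_mem a (Finset.mem_univ a) w' hw')] at hww
      exact h.neighbor_inj a (Finset.mem_univ a) w w' hw hw' hww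
    have himage : (G.neighborFinset (z a)).image c' = Finset.univ.erase a := by
      refine Finset.eq_of_subset_of_card_le (fun x hx => ?_) ?_
      · obtain ⟨w, hw, rfl⟩ := Finset.mem_image.1 hx
        have hw : G.Adj (z a) w := by simpa using hw
        exact Finset.mem_erase.2 ⟨fun hwa => hc' _ _ hw (hza.trans hwa.symm), Finset.mem_univ _⟩
      · rw [Finset.card_image_of_injOn hinj, G.card_neighborFinset_eq_degree, hreg,
          Finset.card_erase_of_mem (Finset.mem_univ _), Finset.card_univ, Fintype.card_fin]
        omega
    obtain ⟨w, hw, hwb⟩ := Finset.mem_image.1 (himage ▸ Finset.mem_erase.2 ⟨hb, Finset.mem_univ b⟩)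
    exact ⟨w, by simpa using hw, hwb⟩

variable {V : Type*} [Fintype V] [DecidableEq V] {G : SimpleGraph V} [DecidableRel G.Adj]
  {d : ℕ} {D : Finset (Fin (d + 1))} {z : Fin (d + 1) → V} {S : Finset V} {c : V → Fin (d + 1)}

theorem sum_card_neighborFinset_sdiff_le (h : IsPartialBColoring G D z S c)
    (hreg : G.IsRegularOfDegree d) :
    ∑ w ∈ S, (G.neighborFinset w \ S).card ≤ D.card * d * (d - 1) := by
  set T := D.biUnion fun a => G.neighborFinset (z a) with hT
  have hTS : T ⊆ S := by
    intro w hw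
    obtain ⟨a, ha, hw⟩ := Finset.mem_biUnion.1 hw
    exact h.neighbor_mem a ha w (by simpa using hw)
  have hsum : ∑ w ∈ S, (G.neighborFinset w \ S).card = ∑ w ∈ T, (G.neighborFinset w \ S).card := by
    refine (Finset.sum_subset hTS fun w hw hwT => ?_).symm
    obtain ⟨a, ha, rfl | haw⟩ := h.cover w hw
    · rw [Finset.card_eq_zero, Finset.sdiff_eq_empty_iff_subset]
      intro x hx
      exact h.neighbor_mem a ha x (by simpa using hx)
    · exact absurd (Finset.mem_biUnion.2 ⟨a, ha, by simpa using haw⟩) hwT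
  have hTcard : T.card ≤ D.card * d :=
    Finset.card_biUnion_le_card_mul _ _ _ fun a _ => by
      rw [G.card_neighborFinset_eq_degree, hreg]
  rw [hsum]
  refine (Finset.sum_le_card_nsmul _ _ (d - 1) fun w hw => ?_).trans
    (Nat.mul_le_mul_right _ hTcard)
  obtain ⟨a, ha, haw⟩ := Finset.mem_biUnion.1 hw
  have haw : G.Adj w (z a) := by simpa [G.adj_comm] using haw
  have hsub : G.neighborFinset w \ S ⊆ (G.neighborFinset w).erase (z a) := by
    intro x hx
    rw [Finset.mem_sdiff] at hx
    exact Finset.mem_erase.2 ⟨fun hxz => hx.2 (hxz ▸ h.center_mem a ha), hx.1⟩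
  have := Finset.card_le_card hsub
  rwa [Finset.card_erase_of_mem (by simpa using haw), G.card_neighborFinset_eq_degree, hreg] at this

theorem exists_neighbor_coloring (h : IsPartialBColoring G D z S c)
    (hreg : G.IsRegularOfDegree d) (hgirth : (5 : ℕ∞) ≤ G.girth) {a : Fin (d + 1)} (ha : a ∉ D)
    {v : V} (hno : ∀ w ∈ S, G.Adj v w → c w ≠ a)
    (hsparse : (v ∉ S ∧ (coloredNeighbors G S c a v).card = 0 ∧
        ∑ u ∈ G.neighborFinset v \ S, (coloredNeighbors G S c a u).card + 2 < 2 * d) ∨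
      ((coloredNeighbors G S c a v).card = 1 ∧
        ∑ u ∈ G.neighborFinset v \ S, (coloredNeighbors G S c a u).card + 1 < d)) :
    ∃ φ : V → Fin (d + 1), Set.InjOn φ (G.neighborFinset v \ S : Finset V) ∧
      ∀ u ∈ G.neighborFinset v \ S, φ u ≠ a ∧ (∀ w ∈ S, G.Adj v w → c w ≠ φ u) ∧
        ∀ w ∈ S, G.Adj u w → c w ≠ φ u := by
  set N := G.neighborFinset v \ S with hN
  set P := (Finset.univ.erase a) \ (coloredNeighbors G S c a v).image c with hP
  have hPcard : d ≤ P.card + (coloredNeighbors G S c a v).card := by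
    have h1 := Finset.le_card_sdiff ((coloredNeighbors G S c a v).image c) (Finset.univ.erase a)
    rw [← hP, Finset.card_erase_of_mem (Finset.mem_univ _), Finset.card_univ,
      Fintype.card_fin] at h1
    have h2 : ((coloredNeighbors G S c a v).image c).card ≤ _ := Finset.card_image_le
    omega
  have hNcard : N.card + (coloredNeighbors G S c a v).card = d := by
    have h1 : coloredNeighbors G S c a v = G.neighborFinset v ∩ S := by
      ext w
      simp only [coloredNeighbors, Finset.mem_filter, Finset.mem_inter, G.mem_neighborFinset]
      exact ⟨fun hw => ⟨hw.2.1, hw.1⟩, fun hw => ⟨hw.2, hw.1, hno w hw.2 hw.1⟩⟩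
    rw [h1, Finset.card_sdiff_add_card_inter, G.card_neighborFinset_eq_degree, hreg]
  let allowed : N → Finset (Fin (d + 1)) := fun u => P \ (coloredNeighbors G S c a u).image c
  have hall : ∀ X : Finset N, X.card ≤ (X.biUnion allowed).card := by
    intro X
    by_contra! hlt
    set C := P \ X.biUnion allowed with hC
    have hCcard : d + 1 ≤ C.card + X.card + (coloredNeighbors G S c a v).card := by
      have := Finset.le_card_sdiff (X.biUnion allowed) P
      rw [← hC] at this
      omega
    have hXN : X.card ≤ N.card := by
      simpa using Finset.card_le_univ X
    have hCsub : ∀ x ∈ X, C ⊆ (coloredNeighbors G S c a x).image c := by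
      intro x hx b hb
      rw [hC, Finset.mem_sdiff] at hb
      by_contra hbx
      exact hb.2 (Finset.mem_biUnion.2 ⟨x, hx, Finset.mem_sdiff.2 ⟨hb.1, hbx⟩⟩)
    have hCle : ∀ x ∈ X, C.card ≤ (coloredNeighbors G S c a x).card := fun x hx =>
      (Finset.card_le_card (hCsub x hx)).trans Finset.card_image_le
    have hprod : X.card * C.card ≤ ∑ u ∈ N, (coloredNeighbors G S c a u).card := by
      calc X.card * C.card ≤ ∑ x ∈ X, (coloredNeighbors G S c a x).card := by
            simpa using Finset.card_nsmul_le_sum X _ _ hCle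
        _ ≤ ∑ x : N, (coloredNeighbors G S c a x).card :=
            Finset.sum_le_sum_of_subset (Finset.subset_univ X)
        _ = _ := Finset.sum_coe_sort N fun u => (coloredNeighbors G S c a u).card
    have hXpos : 0 < X.card := by omega
    rcases hsparse with ⟨hvS, ht, hf⟩ | ⟨ht, hf⟩
    · rw [ht] at hCcard hNcard
      have hX2 : X.card ≠ 1 := by
        intro hX1
        obtain ⟨x, hx⟩ := Finset.card_pos.1 hXpos
        have hxv : G.Adj v x := by
          have := (Finset.mem_sdiff.1 x.2).1
          simpa using this
        have hsub : coloredNeighbors G S c a x ⊆ (G.neighborFinset (x : V)).erase v := by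
          intro w hw
          rw [coloredNeighbors, Finset.mem_filter] at hw
          exact Finset.mem_erase.2 ⟨fun hwv => hvS (hwv ▸ hw.1), by simpa using hw.2.1⟩
        have h1 := Finset.card_le_card hsub
        rw [Finset.card_erase_of_mem (by simpa using hxv.symm), G.card_neighborFinset_eq_degree,
          hreg] at h1
        have := hCle x hx
        omega
      have hXd : X.card ≠ d := by
        intro hXd
        obtain ⟨b, hb⟩ : C.Nonempty := Finset.card_pos.1 (by omega)
        have hba : b ≠ a := by
          have := (Finset.mem_sdiff.1 (Finset.mem_sdiff.1 hb).1).1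
          simpa using this
        have := h.card_lt_of_forall_adj_color hgirth ha hba hvS
          (X := X.map (Function.Embedding.subtype _)) (by
            intro x hx
            obtain ⟨y, -, rfl⟩ := Finset.mem_map.1 hx
            have := (Finset.mem_sdiff.1 y.2).1
            simpa using this) (by
            intro x hx
            obtain ⟨y, -, rfl⟩ := Finset.mem_map.1 hx
            exact (Finset.mem_sdiff.1 y.2).2) (by
            intro x hx
            obtain ⟨y, hy, rfl⟩ := Finset.mem_map.1 hx
            obtain ⟨w, hw, hwb⟩ := Finset.mem_image.1 (hCsub y hy hb)
            rw [coloredNeighbors, Finset.mem_filter] at hw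
            exact ⟨w, hw.1, hw.2.1, hwb⟩)
        rw [Finset.card_map] at this
        omega
      obtain ⟨p, hp⟩ : ∃ p, X.card = p + 2 := ⟨X.card - 2, by omega⟩
      obtain ⟨r, hr⟩ : ∃ r, d = p + 3 + r := ⟨d - (p + 3), by omega⟩
      have hCr : r + 2 ≤ C.card := by omega
      have := (Nat.mul_le_mul_left X.card hCr).trans hprod
      rw [hp] at this
      nlinarith [Nat.zero_le (p * r)]
    · rw [ht] at hCcard hNcard
      obtain ⟨p, hp⟩ : ∃ p, X.card = p + 1 := ⟨X.card - 1, by omega⟩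
      obtain ⟨r, hr⟩ : ∃ r, d = p + 2 + r := ⟨d - (p + 2), by omega⟩
      have hCr : r + 1 ≤ C.card := by omega
      have := (Nat.mul_le_mul_left X.card hCr).trans hprod
      rw [hp] at this
      nlinarith [Nat.zero_le (p * r)]
  obtain ⟨f, hfinj, hf⟩ := (Finset.all_card_le_biUnion_card_iff_exists_injective allowed).1 hall
  refine ⟨fun u => if hu : u ∈ N then f ⟨u, hu⟩ else a, fun u hu u' hu' huu => ?_, fun u hu => ?_⟩
  · have hu : u ∈ N := hu
    have hu' : u' ∈ N := hu'
    simp only [hu, hu', dif_pos] at huu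
    exact congrArg Subtype.val (hfinj huu)
  · have hfu := hf ⟨u, hu⟩
    simp only [allowed, hP, Finset.mem_sdiff, Finset.mem_erase, Finset.mem_image, coloredNeighbors,
      Finset.mem_filter, Finset.mem_univ, and_true] at hfu
    obtain ⟨⟨hfa, hfv⟩, hfu⟩ := hfu
    simp only [hu, dif_pos]
    refine ⟨hfa, fun w hw hvw hcw => hfv ⟨w, ⟨hw, hvw, hno w hw hvw⟩, hcw⟩,
      fun w hw huw hcw => hfu ⟨w, ⟨hw, huw, ?_⟩, hcw⟩⟩
    rwa [hcw]

theorem exists_insert (h : IsPartialBColoring G D z S c)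
    (hreg : G.IsRegularOfDegree d) (hgirth : (5 : ℕ∞) ≤ G.girth) {a : Fin (d + 1)} (ha : a ∉ D)
    {v : V} (hva : v ∈ S → c v = a) (hno : ∀ w ∈ S, G.Adj v w → c w ≠ a)
    (hsparse : (v ∉ S ∧ (coloredNeighbors G S c a v).card = 0 ∧
        ∑ u ∈ G.neighborFinset v \ S, (coloredNeighbors G S c a u).card + 2 < 2 * d) ∨
      ((coloredNeighbors G S c a v).card = 1 ∧
        ∑ u ∈ G.neighborFinset v \ S, (coloredNeighbors G S c a u).card + 1 < d)) :
    ∃ c', IsPartialBColoring G (insert a D) (Function.update z a v)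
      (insert v (S ∪ G.neighborFinset v)) c' := by
  obtain ⟨φ, hinj, hφ⟩ := h.exists_neighbor_coloring hreg hgirth ha hno hsparse
  have hsingle : ∀ w ∈ S, ∀ w' ∈ S, G.Adj v w → G.Adj v w' → w = w' := by
    intro w hw w' hw' hvw hvw'
    have hle : (coloredNeighbors G S c a v).card ≤ 1 := by omega
    exact Finset.card_le_one.1 hle _ (Finset.mem_filter.2 ⟨hw, hvw, hno w hw hvw⟩) _
      (Finset.mem_filter.2 ⟨hw', hvw', hno w' hw' hvw'⟩)
  have hinj' : ∀ u u', G.Adj v u → u ∉ S → G.Adj v u' → u' ∉ S → φ u = φ u' → u = u' :=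
    fun u u' hu huS hu' huS' => hinj (by simp [hu, huS]) (by simp [hu', huS'])
  have hφ' : ∀ u, G.Adj v u → u ∉ S → φ u ≠ a ∧ (∀ w ∈ S, G.Adj v w → c w ≠ φ u) ∧
      ∀ w ∈ S, G.Adj u w → c w ≠ φ u := fun u hu huS => hφ u (by simp [hu, huS])
  have hself : ∀ u, G.Adj v u → u ≠ v := fun u hu => hu.ne'
  set c' : V → Fin (d + 1) := fun u => if u ∈ S then c u else if u = v then a else φ u with hc'
  have hcS : ∀ u ∈ S, c' u = c u := fun u hu => if_pos hu
  have hcv : c' v = a := by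
    by_cases hv : v ∈ S
    · rw [hcS v hv, hva hv]
    · simp [hc', hv]
  have hcN : ∀ u, G.Adj v u → u ∉ S → c' u = φ u := fun u hu huS => by
    simp [hc', huS, hself u hu]
  have hmem : ∀ u, u ∈ insert v (S ∪ G.neighborFinset v) ↔
      u = v ∨ u ∈ S ∨ (G.Adj v u ∧ u ∉ S) := by
    intro u; simp; tauto
  have hza : ∀ b ∈ D, Function.update z a v b = z b := fun b hb =>
    Function.update_of_ne (by rintro rfl; exact ha hb) _ _
  have hvw : ∀ w, G.Adj v w → c' w ≠ a := by
    intro w hw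
    by_cases hwS : w ∈ S
    · rw [hcS w hwS]; exact hno w hwS hw
    · rw [hcN w hw hwS]; exact (hφ' w hw hwS).1
  refine ⟨c', ?_, ?_, ?_, ?_, ?_, ?_⟩
  · intro u hu w hw huw
    rw [hmem] at hu hw
    rcases hu with rfl | hu | ⟨hu, huS⟩
    · rw [hcv]; exact (hvw w huw).symm
    · rcases hw with rfl | hw | ⟨hw, hwS⟩
      · rw [hcv]; exact hvw u huw.symm
      · rw [hcS u hu, hcS w hw]; exact h.proper u hu w hw huw
      · rw [hcS u hu, hcN w hw hwS]; exact (hφ' w hw hwS).2.2 u hu huw.symm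
    · rcases hw with rfl | hw | ⟨hw, hwS⟩
      · rw [hcv]; exact hvw u huw.symm
      · rw [hcS w hw, hcN u hu huS]; exact ((hφ' u hu huS).2.2 w hw huw).symm
      · exact absurd huw (not_adj_of_common_neighbor G hgirth hu.symm hw.symm)
  · intro b hb
    rcases Finset.mem_insert.1 hb with rfl | hb
    · simp
    · rw [hza b hb, hmem]; exact Or.inr (Or.inl (h.center_mem b hb))
  · intro b hb
    rcases Finset.mem_insert.1 hb with rfl | hb
    · simpa using hcv
    · rw [hza b hb, hcS _ (h.center_mem b hb), h.center_color b hb]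
  · intro b hb w hw
    rcases Finset.mem_insert.1 hb with rfl | hb
    · simp at hw ⊢; tauto
    · rw [hza b hb] at hw
      rw [hmem]; exact Or.inr (Or.inl (h.neighbor_mem b hb w hw))
  · intro b hb w w' hw hw' hww
    rcases Finset.mem_insert.1 hb with rfl | hb
    · rw [Function.update_self] at hw hw'
      by_cases hwS : w ∈ S <;> by_cases hwS' : w' ∈ S
      · exact hsingle w hwS w' hwS' hw hw'
      · rw [hcS w hwS, hcN w' hw' hwS'] at hww
        exact absurd hww ((hφ' w' hw' hwS').2.1 w hwS hw)
      · rw [hcS w' hwS', hcN w hw hwS] at hww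
        exact absurd hww.symm ((hφ' w hw hwS).2.1 w' hwS' hw')
      · rw [hcN w hw hwS, hcN w' hw' hwS'] at hww
        exact hinj' w w' hw hwS hw' hwS' hww
    · rw [hza b hb] at hw hw'
      rw [hcS w (h.neighbor_mem b hb w hw), hcS w' (h.neighbor_mem b hb w' hw')] at hww
      exact h.neighbor_inj b hb w w' hw hw' hww
  · intro u hu
    rw [hmem] at hu
    rcases hu with rfl | hu | ⟨hu, -⟩
    · exact ⟨a, Finset.mem_insert_self _ _, by simp⟩
    · obtain ⟨b, hb, hbu⟩ := h.cover u hu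
      exact ⟨b, Finset.mem_insert_of_mem hb, by rwa [hza b hb]⟩
    · exact ⟨a, Finset.mem_insert_self _ _, by simp [hu]⟩

end IsPartialBColoring

theorem exists_isPartialBColoring_two {V : Type*} [Fintype V] [DecidableEq V] (G : SimpleGraph V)
    [DecidableRel G.Adj] [Nonempty V] {d : ℕ} (hd : 2 ≤ d) (hreg : G.IsRegularOfDegree d)
    (hgirth : (5 : ℕ∞) ≤ G.girth) :
    ∃ (D : Finset (Fin (d + 1))) (z : Fin (d + 1) → V) (S : Finset V) (c : V → Fin (d + 1)),
      IsPartialBColoring G D z S c ∧ D.card = 2 ∧ S.card + 1 ≤ 2 * (d + 1) := by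
  obtain ⟨v⟩ := ‹Nonempty V›
  have h0 : IsPartialBColoring G (∅ : Finset (Fin (d + 1))) (fun _ => v) ∅ (fun _ => 0) := by
    constructor <;> simp
  obtain ⟨c, h1⟩ := h0.exists_insert hreg hgirth (a := 0) (v := v) (Finset.notMem_empty _)
    (by simp) (by simp) (Or.inl (by simp [coloredNeighbors]; omega))
  rw [Finset.empty_union] at h1
  set S := insert v (G.neighborFinset v) with hS
  have hmem : ∀ w, w ∈ S ↔ w = v ∨ G.Adj v w := by simp [hS]
  obtain ⟨x, hx⟩ : (G.neighborFinset v).Nonempty := by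
    rw [← Finset.card_pos, G.card_neighborFinset_eq_degree, hreg]; omega
  have hvx : G.Adj v x := by simpa using hx
  have hxS : x ∈ S := (hmem x).2 (Or.inr hvx)
  have hvS : v ∈ S := (hmem v).2 (Or.inl rfl)
  have hcv : c v = 0 := by simpa using h1.center_color 0 (by simp)
  have hx0 : c x ≠ 0 := fun h => h1.proper v hvS x hxS hvx (hcv.trans h.symm)
  have hinter : ∀ w ∈ S, G.Adj x w → w = v := by
    intro w hw hxw
    rcases (hmem w).1 hw with rfl | hvw
    · rfl
    · exact absurd hvw (not_adj_of_common_neighbor G hgirth hvx hxw.symm)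
  have hcolored : coloredNeighbors G S c (c x) x = {v} := by
    ext w
    simp only [coloredNeighbors, Finset.mem_filter, Finset.mem_singleton]
    refine ⟨fun hw => hinter w hw.1 hw.2.1, ?_⟩
    rintro rfl
    exact ⟨hvS, hvx.symm, by rw [hcv]; exact hx0.symm⟩
  have hempty : ∀ u ∈ G.neighborFinset x \ S, (coloredNeighbors G S c (c x) u).card = 0 := by
    intro u hu
    rw [Finset.mem_sdiff, G.mem_neighborFinset] at hu
    rw [Finset.card_eq_zero, coloredNeighbors, Finset.filter_eq_empty_iff]
    rintro w hw ⟨huw, hcw⟩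
    rcases (hmem w).1 hw with rfl | hvw
    · exact hu.2 ((hmem u).2 (Or.inr huw.symm))
    · exact hcw (congrArg c (eq_of_two_common_neighbors G hgirth hvw hvx huw hu.1.symm
        fun h => hu.2 (h ▸ hvS)))
  obtain ⟨c', h2⟩ := h1.exists_insert hreg hgirth (a := c x) (v := x) (by simpa using hx0)
    (fun _ => rfl) (fun w hw hxw => by rw [hinter w hw hxw, hcv]; exact hx0.symm)
    (Or.inr ⟨by rw [hcolored, Finset.card_singleton],
      by rw [Finset.sum_eq_zero hempty]; omega⟩)
  refine ⟨_, _, _, c', h2, ?_, ?_⟩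
  · rw [Finset.card_insert_of_notMem (by simpa using hx0)]; simp
  · have hScard : S.card ≤ d + 1 := by
      have := Finset.card_insert_le v (G.neighborFinset v)
      rwa [G.card_neighborFinset_eq_degree, hreg] at this
    have hpos : 0 < (S ∩ G.neighborFinset x).card :=
      Finset.card_pos.2 ⟨v, by simpa [hvS] using hvx.symm⟩
    have hunion := Finset.card_union_add_card_inter S (G.neighborFinset x)
    rw [G.card_neighborFinset_eq_degree, hreg] at hunion
    rw [Finset.insert_eq_self.2 (Finset.mem_union_left _ hxS)]
    omega

theorem exists_isPartialBColoring {V : Type*} [Fintype V] [DecidableEq V] (G : SimpleGraph V)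
    [DecidableRel G.Adj] [Nonempty V] {d : ℕ} (hd : 2 ≤ d) (hreg : G.IsRegularOfDegree d)
    (hgirth : (5 : ℕ∞) ≤ G.girth) (hcard : d ^ 3 + d ≤ Fintype.card V) {m : ℕ} (hm : 2 ≤ m)
    (hmd : m ≤ d + 1) :
    ∃ (D : Finset (Fin (d + 1))) (z : Fin (d + 1) → V) (S : Finset V) (c : V → Fin (d + 1)),
      IsPartialBColoring G D z S c ∧ D.card = m ∧ S.card + 1 ≤ m * (d + 1) := by
  induction m, hm using Nat.le_induction with
  | base => exact exists_isPartialBColoring_two G hd hreg hgirth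
  | succ m hm ih =>
    obtain ⟨D, z, S, c, h, hD, hS⟩ := ih (by omega)
    obtain ⟨a, ha⟩ : ∃ a, a ∉ D := by
      by_contra! hall
      rw [Finset.eq_univ_of_forall hall, Finset.card_univ, Fintype.card_fin] at hD
      omega
    have hout := h.sum_card_neighborFinset_sdiff_le hreg
    rw [hD] at hout
    have hcount : m * (d + 1) + m * d * (d - 1) ≤ d ^ 3 + d := by
      obtain ⟨e, rfl⟩ : ∃ e, d = e + 1 := ⟨d - 1, by omega⟩
      calc m * (e + 1 + 1) + m * (e + 1) * (e + 1 - 1) = m * ((e + 1) ^ 2 + 1) := by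
            rw [Nat.add_sub_cancel]; ring
        _ ≤ (e + 1) * ((e + 1) ^ 2 + 1) := Nat.mul_le_mul_right _ (by omega)
        _ = _ := by ring
    obtain ⟨v, hvS, hno, hsparse⟩ := exists_sparse_vertex G hd hreg S c a (by omega)
    obtain ⟨c', h'⟩ := h.exists_insert hreg hgirth ha (fun hv => absurd hv hvS) hno
      (hsparse.imp (fun hs => ⟨hvS, hs⟩) id)
    refine ⟨_, _, _, c', h', by rw [Finset.card_insert_of_notMem ha, hD], ?_⟩
    have h1 := Finset.card_insert_le v (S ∪ G.neighborFinset v)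
    have h2 := Finset.card_union_le S (G.neighborFinset v)
    rw [G.card_neighborFinset_eq_degree, hreg] at h2
    rw [add_mul]
    omega

/-- The El Sahili–Kouider conjecture holds for `d`-regular graphs (`d ≥ 4`) of girth at
least 5 with at least `d³ + d` vertices: their b-chromatic number is `d + 1`. -/
theorem bChromaticNumber_eq_of_girth_ge_five
    {V : Type*} [Fintype V] (G : SimpleGraph V) [DecidableRel G.Adj]
    (d : ℕ) (hd : 4 ≤ d) (hreg : G.IsRegularOfDegree d)
    (hgirth : (5 : ℕ∞) ≤ G.girth)
    (hcard : d ^ 3 + d ≤ Fintype.card V) :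
    bChromaticNumber G = d + 1 := by
  classical
  have : Nonempty V := Fintype.card_pos_iff.1 (by omega)
  obtain ⟨D, z, S, c, h, hD, -⟩ :=
    exists_isPartialBColoring G (by omega) hreg hgirth hcard (m := d + 1) (by omega) le_rfl
  obtain rfl : D = Finset.univ := by
    rw [← Finset.card_eq_iff_eq_univ, hD, Fintype.card_fin]
  exact IsGreatest.csSup_eq
    ⟨h.exists_isBColoring hreg, fun k ⟨_, hc⟩ => le_of_isBColoring G hreg hc⟩
end
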